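/- arXiv:0912.4064 — 2 statements merged into one kernel-verified Lean document; each statement's English description precedes it below -/
import Mathlib

section
/- Let n ≥ 2 and let U ⊆ ℝⁿ be an open set, and let φ : U → ℝ be smooth. Suppose that for every p ∈ U and every unit vector v ∈ ℝⁿ there are ε(p,v) > 0 and a curve γ_{p,v} : (−ε(p,v), ε(p,v)) → U solving the conformal geodesic equation for φ with γ_{p,v}(0) = p and γ_{p,v}′(0) = v. Assume moreover that for every p ∈ U there is δ(p) > 0 such that for each t ∈ (0, δ(p)) all the curves γ_{p,v} (‖v‖ = 1) are defined at t and the set { γ_{p,v}(t) : ‖v‖ = 1 } is a Euclidean sphere, i.e. equals { x ∈ ℝⁿ : ‖x − c‖ = r } for some c ∈ ℝⁿ and r > 0. Then there exists a function μ : U → ℝ such that Hess φ_p(v, w) = μ(p)·⟨v, w⟩ + ⟨∇φ(p), v⟩·⟨∇φ(p), w⟩ for all p ∈ U and all v, w ∈ ℝⁿ. -/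
open scoped RealInnerProductSpace

noncomputable section

/-- The Hessian of `φ` at `p`, as a bilinear form evaluated at `(v, w)`. -/
def Hess {n : ℕ} (φ : EuclideanSpace ℝ (Fin n) → ℝ)
    (p v w : EuclideanSpace ℝ (Fin n)) : ℝ :=
  fderiv ℝ (fderiv ℝ φ) p v w

/-- `γ` solves the conformal geodesic equation for `φ` on the interval `(-ε, ε)`,
with values in `U`:  `γ″ = ‖γ′‖² ∇φ(γ) − 2 ⟨∇φ(γ), γ′⟩ γ′`. -/
def IsConformalGeodesic {n : ℕ} (U : Set (EuclideanSpace ℝ (Fin n)))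
    (φ : EuclideanSpace ℝ (Fin n) → ℝ) (ε : ℝ)
    (γ : ℝ → EuclideanSpace ℝ (Fin n)) : Prop :=
  (∀ t ∈ Set.Ioo (-ε) ε, γ t ∈ U) ∧
  ContDiffOn ℝ 2 γ (Set.Ioo (-ε) ε) ∧
  ∀ t ∈ Set.Ioo (-ε) ε,
    deriv (deriv γ) t =
      (‖deriv γ t‖ ^ 2) • gradient φ (γ t)
        - (2 * ⟪gradient φ (γ t), deriv γ t⟫) • deriv γ t

open Filter Topology Asymptotics

section

variable {V : Type*} [NormedAddCommGroup V] [InnerProductSpace ℝ V]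

theorem isLittleO_pow_succ_of_eventually_hasDerivAt {f f' : ℝ → V} {k : ℕ}
    (hf : ∀ᶠ t in 𝓝 (0 : ℝ), HasDerivAt f (f' t) t) (h0 : f 0 = 0)
    (hf' : f' =o[𝓝 0] fun t : ℝ ↦ t ^ k) :
    f =o[𝓝 0] fun t : ℝ ↦ t ^ (k + 1) := by
  rw [isLittleO_iff] at hf' ⊢
  intro c hc
  obtain ⟨r, hr, hball⟩ := Metric.eventually_nhds_iff_ball.1 (hf.and (hf' hc))
  filter_upwards [Metric.ball_mem_nhds (0 : ℝ) hr] with t ht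
  have hsub : ∀ s ∈ Metric.closedBall (0 : ℝ) ‖t‖, s ∈ Metric.ball (0 : ℝ) r := by
    intro s hs
    simp only [mem_closedBall_zero_iff, mem_ball_zero_iff] at hs ht ⊢
    exact hs.trans_lt ht
  have key := (convex_closedBall (0 : ℝ) ‖t‖).norm_image_sub_le_of_norm_hasDerivWithin_le
    (f := f) (f' := f') (C := c * ‖t‖ ^ k) (x := 0) (y := t)
    (fun s hs ↦ (hball s (hsub s hs)).1.hasDerivWithinAt)
    (fun s hs ↦ by
      refine (hball s (hsub s hs)).2.trans ?_
      rw [norm_pow]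
      have : ‖s‖ ≤ ‖t‖ := by simpa using hs
      gcongr)
    (by simp) (by simp)
  rw [h0, sub_zero, sub_zero] at key
  rw [norm_pow, pow_succ, ← mul_assoc]
  exact key

theorem hasDerivAt_sq_div_two (t : ℝ) : HasDerivAt (fun t : ℝ ↦ t ^ 2 / 2) t t :=
  ((hasDerivAt_pow 2 t).div_const 2).congr_deriv (by push_cast; ring)

/-- A third-order Taylor expansion with Peano remainder. -/
theorem taylor_three_isLittleO {f f₁ f₂ : ℝ → V} {b : V}
    (h₁ : ∀ᶠ t in 𝓝 (0 : ℝ), HasDerivAt f (f₁ t) t)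
    (h₂ : ∀ᶠ t in 𝓝 (0 : ℝ), HasDerivAt f₁ (f₂ t) t) (h₃ : HasDerivAt f₂ b 0) :
    (fun t : ℝ ↦ f t - f 0 - t • f₁ 0 - (t ^ 2 / 2) • f₂ 0 - (t ^ 3 / 6) • b)
      =o[𝓝 0] fun t : ℝ ↦ t ^ 3 := by
  have e₂ : (fun t : ℝ ↦ f₂ t - f₂ 0 - t • b) =o[𝓝 0] fun t : ℝ ↦ t ^ 1 := by
    simpa using hasDerivAt_iff_isLittleO.1 h₃
  have e₁ : (fun t : ℝ ↦ f₁ t - f₁ 0 - t • f₂ 0 - (t ^ 2 / 2) • b)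
      =o[𝓝 0] fun t : ℝ ↦ t ^ 2 := by
    refine isLittleO_pow_succ_of_eventually_hasDerivAt ?_ (by simp) e₂
    filter_upwards [h₂] with t ht
    simpa using! ((ht.sub_const (f₁ 0)).sub ((hasDerivAt_id t).smul_const (f₂ 0))).sub
      ((hasDerivAt_sq_div_two t).smul_const b)
  refine isLittleO_pow_succ_of_eventually_hasDerivAt ?_ (by simp) e₁
  filter_upwards [h₁] with t ht
  have hc : HasDerivAt (fun t : ℝ ↦ t ^ 3 / 6) (t ^ 2 / 2) t :=
    ((hasDerivAt_pow 3 t).div_const 6).congr_deriv (by push_cast; ring)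
  simpa using! (((ht.sub_const (f 0)).sub ((hasDerivAt_id t).smul_const (f₁ 0))).sub
    ((hasDerivAt_sq_div_two t).smul_const (f₂ 0))).sub (hc.smul_const b)

/-- `X` has the expansion `t v + t² a / 2 + t³ b / 6 + o(t³)` as `t → 0⁺`. -/
def HasExpansion (X : ℝ → V) (v a b : V) : Prop :=
  ∃ w : ℝ → V, Tendsto w (𝓝[>] 0) (𝓝 ((1 / 6 : ℝ) • b)) ∧
    ∀ t : ℝ, 0 < t → X t = t • v + (t ^ 2 / 2) • a + t ^ 3 • w t

theorem hasExpansion_of_hasDerivAt {f f₁ f₂ : ℝ → V} {b : V}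
    (h₁ : ∀ᶠ t in 𝓝 (0 : ℝ), HasDerivAt f (f₁ t) t)
    (h₂ : ∀ᶠ t in 𝓝 (0 : ℝ), HasDerivAt f₁ (f₂ t) t) (h₃ : HasDerivAt f₂ b 0) :
    HasExpansion (fun t ↦ f t - f 0) (f₁ 0) (f₂ 0) b := by
  refine ⟨fun t ↦ (t ^ 3)⁻¹ • (f t - f 0 - t • f₁ 0 - (t ^ 2 / 2) • f₂ 0), ?_, ?_⟩
  · have h := ((taylor_three_isLittleO h₁ h₂ h₃).mono
      (nhdsWithin_le_nhds (s := Set.Ioi 0))).tendsto_inv_smul_nhds_zero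
    have h' := h.add_const ((1 / 6 : ℝ) • b)
    rw [zero_add] at h'
    refine h'.congr' ?_
    filter_upwards [self_mem_nhdsWithin] with t ht
    have ht : t ≠ 0 := ne_of_gt ht
    rw [smul_sub _ _ ((t ^ 3 / 6) • b), smul_smul]
    have : (t ^ 3)⁻¹ * (t ^ 3 / 6) = 1 / 6 := by field_simp
    rw [this, sub_add_cancel]
  · intro t ht
    rw [smul_smul, mul_inv_cancel₀ (by positivity), one_smul]
    module

namespace HasExpansion

variable {X : ℝ → V} {v a b : V}

theorem tendsto_inv_smul_sub (h : HasExpansion X v a b) :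
    Tendsto (fun t : ℝ ↦ (t ^ 2)⁻¹ • (X t - t • v)) (𝓝[>] 0) (𝓝 ((1 / 2 : ℝ) • a)) := by
  obtain ⟨w, hw, hX⟩ := h
  have ht : Tendsto (fun t : ℝ ↦ t) (𝓝[>] 0) (𝓝 0) := nhdsWithin_le_nhds
  have := (ht.smul hw).const_add ((1 / 2 : ℝ) • a)
  rw [zero_smul, add_zero] at this
  refine this.congr' ?_
  filter_upwards [self_mem_nhdsWithin] with t ht
  have ht : t ≠ 0 := ne_of_gt ht
  rw [hX t (by assumption)]
  match_scalars <;> (field_simp; try ring)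

theorem tendsto_inv_smul (h : HasExpansion X v a b) :
    Tendsto (fun t : ℝ ↦ t⁻¹ • X t) (𝓝[>] 0) (𝓝 v) := by
  have ht : Tendsto (fun t : ℝ ↦ t) (𝓝[>] 0) (𝓝 0) := nhdsWithin_le_nhds
  have := (ht.smul h.tendsto_inv_smul_sub).const_add v
  rw [zero_smul, add_zero] at this
  refine this.congr' ?_
  filter_upwards [self_mem_nhdsWithin] with t ht
  have ht : t ≠ 0 := ne_of_gt ht
  match_scalars <;> field_simp
  ring

theorem tendsto_norm_sq_four (h : HasExpansion X v a b) (hv : ‖v‖ = 1) :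
    Tendsto (fun t : ℝ ↦ (‖X t‖ ^ 2 - t ^ 2 - t ^ 3 * ⟪v, a⟫) / t ^ 4) (𝓝[>] 0)
      (𝓝 (‖a‖ ^ 2 / 4 + ⟪v, b⟫ / 3)) := by
  obtain ⟨w, hw, hX⟩ := h
  have ht : Tendsto (fun t : ℝ ↦ t) (𝓝[>] 0) (𝓝 0) := nhdsWithin_le_nhds
  have h1 := (((ht.smul hw).const_add ((1 / 2 : ℝ) • a)).norm.pow 2).add
    ((hw.inner (𝕜 := ℝ) (tendsto_const_nhds (x := v))).const_mul 2)
  have e : ‖(1 / 2 : ℝ) • a + (0 : ℝ) • (1 / 6 : ℝ) • b‖ ^ 2 + 2 * ⟪(1 / 6 : ℝ) • b, v⟫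
      = ‖a‖ ^ 2 / 4 + ⟪v, b⟫ / 3 := by
    rw [zero_smul, add_zero, norm_smul, real_inner_smul_left, real_inner_comm]
    norm_num
    ring
  rw [e] at h1
  refine h1.congr' ?_
  filter_upwards [self_mem_nhdsWithin] with t ht
  have ht' : t ≠ 0 := ne_of_gt ht
  rw [hX t ht]
  have hvv : ⟪v, v⟫ = 1 := by rw [real_inner_self_eq_norm_sq, hv]; norm_num
  simp only [← real_inner_self_eq_norm_sq, inner_add_left, inner_add_right,
    real_inner_smul_left, real_inner_smul_right, real_inner_comm v, hvv, real_inner_comm a (w t)]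
  field_simp
  ring

theorem tendsto_norm_sq_three (h : HasExpansion X v a b) (hv : ‖v‖ = 1) :
    Tendsto (fun t : ℝ ↦ (‖X t‖ ^ 2 - t ^ 2) / t ^ 3) (𝓝[>] 0) (𝓝 ⟪v, a⟫) := by
  have ht : Tendsto (fun t : ℝ ↦ t) (𝓝[>] 0) (𝓝 0) := nhdsWithin_le_nhds
  have := (ht.mul (h.tendsto_norm_sq_four hv)).const_add ⟪v, a⟫
  rw [zero_mul, add_zero] at this
  refine this.congr' ?_
  filter_upwards [self_mem_nhdsWithin] with t ht
  have ht : t ≠ 0 := ne_of_gt ht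
  field_simp
  ring

end HasExpansion

theorem tendsto_of_tendsto_inner {ι α : Type*} [Fintype ι] (e : OrthonormalBasis ι ℝ V)
    {l : Filter α} {u : ι → α → V} {Q : α → V} {L : V}
    (hu : ∀ i, Tendsto (u i) l (𝓝 (e i)))
    (hQ : ∀ i, Tendsto (fun x ↦ ⟪u i x, Q x⟫) l (𝓝 ⟪e i, L⟫)) :
    Tendsto Q l (𝓝 L) := by
  have hD : Tendsto (fun x ↦ 2 * ∑ i, |⟪u i x, Q x - L⟫|) l (𝓝 0) := by
    have : Tendsto (fun x ↦ 2 * ∑ i, |⟪u i x, Q x⟫ - ⟪u i x, L⟫|) l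
        (𝓝 (2 * ∑ i, |⟪e i, L⟫ - ⟪e i, L⟫|)) :=
      (tendsto_finsetSum _ fun i _ ↦
        ((hQ i).sub ((hu i).inner tendsto_const_nhds)).abs).const_mul 2
    simpa [inner_sub_right] using this
  have hs : Tendsto (fun x ↦ ∑ i, ‖e i - u i x‖) l (𝓝 0) := by
    have : Tendsto (fun x ↦ ∑ i, ‖e i - u i x‖) l (𝓝 (∑ i, ‖e i - e i‖)) :=
      tendsto_finsetSum _ fun i _ ↦ ((hu i).const_sub (e i)).norm
    simpa using this
  rw [tendsto_iff_norm_sub_tendsto_zero]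
  refine squeeze_zero' (Eventually.of_forall fun _ ↦ norm_nonneg _) ?_ hD
  filter_upwards [hs.eventually (ge_mem_nhds (show (0 : ℝ) < 1 / 2 by norm_num))] with x hx
  have h1 : ‖Q x - L‖ ≤ ∑ i, |⟪e i, Q x - L⟫| := by
    calc ‖Q x - L‖ = ‖∑ i, ⟪e i, Q x - L⟫ • e i‖ := by rw [e.sum_repr' (Q x - L)]
      _ ≤ ∑ i, ‖⟪e i, Q x - L⟫ • e i‖ := norm_sum_le _ _
      _ = ∑ i, |⟪e i, Q x - L⟫| := by simp [norm_smul]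
  have h2 : ∑ i, |⟪e i, Q x - L⟫|
      ≤ ∑ i, |⟪u i x, Q x - L⟫| + (∑ i, ‖e i - u i x‖) * ‖Q x - L‖ := by
    rw [Finset.sum_mul, ← Finset.sum_add_distrib]
    gcongr with i
    have : ⟪e i, Q x - L⟫ = ⟪u i x, Q x - L⟫ + ⟪e i - u i x, Q x - L⟫ := by
      rw [inner_sub_left (e i)]; ring
    rw [this]
    exact (abs_add_le _ _).trans (by gcongr; exact abs_real_inner_le_norm _ _)
  nlinarith [norm_nonneg (Q x - L)]

/-- If the points `X v t` with `‖v‖ = 1` lie on a common sphere of centre `C t` for each small `t`,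
and the curves `X v` have initial accelerations `G - 2 ⟪G, v⟫ v`, then `C t = -t² G / 2 + o(t²)`. -/
theorem tendsto_center {ι : Type*} [Fintype ι] (e : OrthonormalBasis ι ℝ V) {G : V}
    {X : V → ℝ → V} {b : V → V} {C : ℝ → V} {R : ℝ → ℝ}
    (hX : ∀ v, ‖v‖ = 1 → HasExpansion (X v) v (G - (2 * ⟪G, v⟫) • v) (b v))
    (hC : ∀ᶠ t in 𝓝[>] (0 : ℝ), ∀ v, ‖v‖ = 1 → ‖X v t‖ ^ 2 - 2 * ⟪X v t, C t⟫ = R t) :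
    Tendsto (fun t : ℝ ↦ (t ^ 2)⁻¹ • C t) (𝓝[>] 0) (𝓝 (-(1 / 2 : ℝ) • G)) := by
  have hn (i : ι) : ‖-e i‖ = 1 := by simp
  refine tendsto_of_tendsto_inner e
    (u := fun i t ↦ (1 / 2 : ℝ) • (t⁻¹ • X (e i) t - t⁻¹ • X (-e i) t)) (fun i ↦ ?_) (fun i ↦ ?_)
  · have := ((hX (e i) (by simp)).tendsto_inv_smul.sub (hX _ (hn i)).tendsto_inv_smul).const_smul
      (1 / 2 : ℝ)
    convert this using 2
    module
  · have := (((hX (e i) (by simp)).tendsto_norm_sq_three (by simp)).sub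
      ((hX _ (hn i)).tendsto_norm_sq_three (hn i))).const_mul (1 / 4)
    have hee : ⟪e i, e i⟫ = 1 := by simp
    have e1 : 1 / 4 * (⟪e i, G - (2 * ⟪G, e i⟫) • e i⟫ - ⟪-e i, G - (2 * ⟪G, -e i⟫) • -e i⟫)
        = ⟪e i, -(1 / 2 : ℝ) • G⟫ := by
      simp only [inner_sub_right, inner_neg_left, inner_neg_right, real_inner_smul_right,
        hee, real_inner_comm (e i) G]
      ring
    rw [e1] at this
    refine this.congr' ?_
    filter_upwards [self_mem_nhdsWithin, hC] with t ht hCt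
    have ht : t ≠ 0 := ne_of_gt ht
    have h1 := hCt (e i) (by simp)
    have h2 := hCt _ (hn i)
    simp only [real_inner_smul_left, real_inner_smul_right, inner_sub_left]
    field_simp
    linarith

/-- Under the assumptions of `tendsto_center`, the `t⁴` term of the sphere equation is independent of
the direction. -/
theorem quartic_coefficient_eq {ι : Type*} [Fintype ι] (e : OrthonormalBasis ι ℝ V) {G : V}
    {X : V → ℝ → V} {b : V → V} {C : ℝ → V} {R : ℝ → ℝ}
    (hX : ∀ v, ‖v‖ = 1 → HasExpansion (X v) v (G - (2 * ⟪G, v⟫) • v) (b v))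
    (hb : ∀ v, b (-v) = -b v)
    (hC : ∀ᶠ t in 𝓝[>] (0 : ℝ), ∀ v, ‖v‖ = 1 → ‖X v t‖ ^ 2 - 2 * ⟪X v t, C t⟫ = R t)
    {v w : V} (hv : ‖v‖ = 1) (hw : ‖w‖ = 1) :
    ⟪v, b v⟫ - 3 * ⟪G, v⟫ ^ 2 = ⟪w, b w⟫ - 3 * ⟪G, w⟫ ^ 2 := by
  have key (v : V) (hv : ‖v‖ = 1) : Tendsto (fun t : ℝ ↦ (R t - t ^ 2) / t ^ 4) (𝓝[>] 0)
      (𝓝 (3 / 4 * ‖G‖ ^ 2 + (⟪v, b v⟫ - 3 * ⟪G, v⟫ ^ 2) / 3)) := by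
    have hn : ‖-v‖ = 1 := by simpa
    have h1 := ((hX v hv).tendsto_norm_sq_four hv).add ((hX _ hn).tendsto_norm_sq_four hn)
    have h2 := ((hX v hv).tendsto_inv_smul_sub.add (hX _ hn).tendsto_inv_smul_sub).inner (𝕜 := ℝ)
      (tendsto_center e hX hC)
    have h3 := (h1.sub (h2.const_mul 2)).const_mul (1 / 2)
    have hvv : ⟪v, v⟫ = 1 := by rw [real_inner_self_eq_norm_sq, hv]; norm_num
    convert h3.congr' ?_ using 2
    · simp only [hb, ← real_inner_self_eq_norm_sq, inner_sub_right, inner_sub_left, inner_add_left,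
        inner_neg_left, inner_neg_right, real_inner_smul_left, real_inner_smul_right, hvv,
        real_inner_comm v G]
      ring
    · filter_upwards [self_mem_nhdsWithin, hC] with t ht hCt
      have ht : t ≠ 0 := ne_of_gt ht
      have h1 := hCt v hv
      have h2 := hCt _ hn
      simp only [real_inner_smul_left, real_inner_smul_right, inner_sub_left, inner_sub_right,
        inner_add_left, inner_neg_left, inner_neg_right]
      field_simp
      linarith
  have := tendsto_nhds_unique (key v hv) (key w hw)
  linarith

end

section

variable {n : ℕ} {U : Set (EuclideanSpace ℝ (Fin n))} {φ : EuclideanSpace ℝ (Fin n) → ℝ}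
  {p : EuclideanSpace ℝ (Fin n)}

/-- The real-linear Riesz map, sending a continuous linear form to the vector representing it. -/
def rieszMap (n : ℕ) :
    StrongDual ℝ (EuclideanSpace ℝ (Fin n)) →L[ℝ] EuclideanSpace ℝ (Fin n) where
  toFun := (InnerProductSpace.toDual ℝ (EuclideanSpace ℝ (Fin n))).symm
  map_add' := map_add _
  map_smul' c f := by simp
  cont := (InnerProductSpace.toDual ℝ (EuclideanSpace ℝ (Fin n))).symm.continuous

/-- The Hessian of `φ` at `p` as an endomorphism. -/
def hessianOp (φ : EuclideanSpace ℝ (Fin n) → ℝ) (p : EuclideanSpace ℝ (Fin n)) :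
    EuclideanSpace ℝ (Fin n) →L[ℝ] EuclideanSpace ℝ (Fin n) :=
  (rieszMap n).comp (fderiv ℝ (fderiv ℝ φ) p)

theorem inner_hessianOp (v w : EuclideanSpace ℝ (Fin n)) :
    ⟪hessianOp φ p v, w⟫ = Hess φ p v w :=
  InnerProductSpace.toDual_symm_apply (𝕜 := ℝ)

theorem hasFDerivAt_gradient (hφ : ContDiffAt ℝ 2 φ p) :
    HasFDerivAt (gradient φ) (hessianOp φ p) p :=
  (rieszMap n).hasFDerivAt.comp p
    ((hφ.fderiv_right (m := 1) (by norm_num)).differentiableAt (by norm_num)).hasFDerivAt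

/-- The initial third derivative of the conformal geodesic with initial velocity `v`. -/
def geodesicJerk (φ : EuclideanSpace ℝ (Fin n) → ℝ) (p v : EuclideanSpace ℝ (Fin n)) :
    EuclideanSpace ℝ (Fin n) :=
  let G := gradient φ p
  let a := G - (2 * ⟪G, v⟫) • v
  (2 * ⟪v, a⟫) • G + hessianOp φ p v
    - ((2 * (⟪hessianOp φ p v, v⟫ + ⟪G, a⟫)) • v + (2 * ⟪G, v⟫) • a)

theorem geodesicJerk_neg (v : EuclideanSpace ℝ (Fin n)) :
    geodesicJerk φ p (-v) = -geodesicJerk φ p v := by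
  simp only [geodesicJerk, inner_neg_left, inner_neg_right, map_neg, mul_neg, smul_neg, neg_smul, neg_neg]
  module

theorem inner_geodesicJerk {v : EuclideanSpace ℝ (Fin n)} (hv : ‖v‖ = 1) :
    ⟪v, geodesicJerk φ p v⟫ - 3 * ⟪gradient φ p, v⟫ ^ 2
      = ⟪gradient φ p, v⟫ ^ 2 - Hess φ p v v - 2 * ‖gradient φ p‖ ^ 2 := by
  have hvv : ⟪v, v⟫ = 1 := by rw [real_inner_self_eq_norm_sq, hv]; norm_num
  simp only [geodesicJerk, ← inner_hessianOp, ← real_inner_self_eq_norm_sq, inner_add_right,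
    inner_sub_right, real_inner_smul_right, hvv, real_inner_comm (gradient φ p) v,
    real_inner_comm (hessianOp φ p v) v]
  ring

theorem IsConformalGeodesic.hasExpansion {ε : ℝ} {γ : ℝ → EuclideanSpace ℝ (Fin n)}
    {v : EuclideanSpace ℝ (Fin n)} (h : IsConformalGeodesic U φ ε γ) (hε : 0 < ε)
    (h0 : γ 0 = p) (h1 : deriv γ 0 = v) (hv : ‖v‖ = 1) (hφ : ContDiffAt ℝ 2 φ p) :
    HasExpansion (fun t ↦ γ t - p) v (gradient φ p - (2 * ⟪gradient φ p, v⟫) • v)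
      (geodesicJerk φ p v) := by
  obtain ⟨-, hsm, heq⟩ := h
  have hnhds : Set.Ioo (-ε) ε ∈ 𝓝 (0 : ℝ) := Ioo_mem_nhds (by linarith) hε
  have hC (t : ℝ) (ht : t ∈ Set.Ioo (-ε) ε) : ContDiffAt ℝ 2 γ t :=
    hsm.contDiffAt (isOpen_Ioo.mem_nhds ht)
  have d1 (t : ℝ) (ht : t ∈ Set.Ioo (-ε) ε) : HasDerivAt γ (deriv γ t) t :=
    ((hC t ht).differentiableAt (by norm_num)).hasDerivAt
  have d2 (t : ℝ) (ht : t ∈ Set.Ioo (-ε) ε) : HasDerivAt (deriv γ) (deriv (deriv γ) t) t := by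
    have : ContDiffOn ℝ 1 (deriv γ) (Set.Ioo (-ε) ε) :=
      hsm.deriv_of_isOpen isOpen_Ioo (by norm_num)
    exact ((this.contDiffAt (isOpen_Ioo.mem_nhds ht)).differentiableAt (by norm_num)).hasDerivAt
  have hmem : (0 : ℝ) ∈ Set.Ioo (-ε) ε := mem_of_mem_nhds hnhds
  have ha : deriv (deriv γ) 0 = gradient φ p - (2 * ⟪gradient φ p, v⟫) • v := by
    rw [heq 0 hmem, h0, h1, hv]
    simp
  have hG : HasDerivAt (fun t ↦ gradient φ (γ t)) (hessianOp φ p v) 0 := by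
    have := h1 ▸ d1 0 hmem
    exact (hasFDerivAt_gradient hφ).comp_hasDerivAt_of_eq 0 this h0.symm
  have d3 : HasDerivAt (deriv (deriv γ)) (geodesicJerk φ p v) 0 := by
    have hd := d2 0 hmem
    have := (hd.norm_sq.smul hG).sub (((hG.inner ℝ hd).const_mul 2).smul hd)
    rw [ha, h0, h1, hv] at this
    refine (this.congr_deriv ?_).congr_of_eventuallyEq ?_
    · simp only [geodesicJerk]
      module
    · filter_upwards [hnhds] with t ht
      exact heq t ht
  have := hasExpansion_of_hasDerivAt (Filter.mem_of_superset hnhds d1)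
    (Filter.mem_of_superset hnhds d2) d3
  rwa [h0, h1, ha] at this

end

/-- A symmetric bilinear form that is constant on the diagonal over the unit sphere is a multiple of
the inner product. -/
theorem bilin_eq_mul_inner {V : Type*} [NormedAddCommGroup V] [InnerProductSpace ℝ V]
    (B : V →ₗ[ℝ] V →ₗ[ℝ] ℝ) (hB : ∀ v w, B v w = B w v) {m : ℝ}
    (hm : ∀ v, ‖v‖ = 1 → B v v = m) (v w : V) : B v w = m * ⟪v, w⟫ := by
  have hdiag (v : V) : B v v = m * ⟪v, v⟫ := by
    rcases eq_or_ne v 0 with rfl | hv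
    · simp
    · have hv' : ‖v‖ ≠ 0 := norm_ne_zero_iff.2 hv
      have := hm (‖v‖⁻¹ • v) (by rw [norm_smul, norm_inv, norm_norm, inv_mul_cancel₀ hv'])
      simp only [map_smul, LinearMap.smul_apply, smul_eq_mul] at this
      rw [real_inner_self_eq_norm_sq]
      field_simp at this
      linarith
  have h := hdiag (v + w)
  simp only [map_add, LinearMap.add_apply, inner_add_left, inner_add_right, hdiag, hB w v,
    real_inner_comm v w] at h
  linarith

/-- If all sufficiently small geodesic hyperspheres of the conformally flat metric
`e^{2φ}·g_euc` are Euclidean spheres, then `Hess φ = μ·g + dφ ⊗ dφ`. -/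
theorem cospherical_hessian {n : ℕ} (hn : 2 ≤ n)
    (U : Set (EuclideanSpace ℝ (Fin n))) (hU : IsOpen U)
    (φ : EuclideanSpace ℝ (Fin n) → ℝ) (hφ : ContDiffOn ℝ (⊤ : ℕ∞) φ U)
    (ε : EuclideanSpace ℝ (Fin n) → EuclideanSpace ℝ (Fin n) → ℝ)
    (γ : EuclideanSpace ℝ (Fin n) → EuclideanSpace ℝ (Fin n) → ℝ →
      EuclideanSpace ℝ (Fin n))
    (hgeo : ∀ p ∈ U, ∀ v : EuclideanSpace ℝ (Fin n), ‖v‖ = 1 →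
      0 < ε p v ∧ IsConformalGeodesic U φ (ε p v) (γ p v) ∧
      γ p v 0 = p ∧ deriv (γ p v) 0 = v)
    (δ : EuclideanSpace ℝ (Fin n) → ℝ)
    (hδ : ∀ p ∈ U, 0 < δ p)
    (hsph : ∀ p ∈ U, ∀ t ∈ Set.Ioo (0 : ℝ) (δ p),
      (∀ v : EuclideanSpace ℝ (Fin n), ‖v‖ = 1 → t < ε p v) ∧
      ∃ (c : EuclideanSpace ℝ (Fin n)) (r : ℝ), 0 < r ∧
        {x | ∃ v : EuclideanSpace ℝ (Fin n), ‖v‖ = 1 ∧ γ p v t = x} =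
          {x | ‖x - c‖ = r}) :
    ∃ μ : EuclideanSpace ℝ (Fin n) → ℝ, ∀ p ∈ U, ∀ v w : EuclideanSpace ℝ (Fin n),
      Hess φ p v w = μ p * ⟪v, w⟫ + ⟪gradient φ p, v⟫ * ⟪gradient φ p, w⟫ := by
  obtain ⟨i₀⟩ : Nonempty (Fin n) := ⟨⟨0, by omega⟩⟩
  set e := EuclideanSpace.basisFun (Fin n) ℝ
  refine ⟨fun p ↦ Hess φ p (e i₀) (e i₀) - ⟪gradient φ p, e i₀⟫ ^ 2, fun p hp v w ↦ ?_⟩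
  have hφp : ContDiffAt ℝ 2 φ p :=
    (hφ.contDiffAt (hU.mem_nhds hp)).of_le (WithTop.coe_le_coe.2 (le_top : (2 : ℕ∞) ≤ ⊤))
  have hex : ∀ t : ℝ, ∃ c : EuclideanSpace ℝ (Fin n), ∃ r : ℝ, t ∈ Set.Ioo (0 : ℝ) (δ p) →
      ∀ v : EuclideanSpace ℝ (Fin n), ‖v‖ = 1 → ‖γ p v t - c‖ = r := by
    intro t
    by_cases ht : t ∈ Set.Ioo (0 : ℝ) (δ p)
    · obtain ⟨-, c, r, -, hset⟩ := hsph p hp t ht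
      exact ⟨c, r, fun _ v hv ↦ (Set.ext_iff.1 hset _).1 ⟨v, hv, rfl⟩⟩
    · exact ⟨0, 0, fun h ↦ absurd h ht⟩
  choose c r hcr using hex
  have hunit {v : EuclideanSpace ℝ (Fin n)} (hv : ‖v‖ = 1) :
      Hess φ p v v - ⟪gradient φ p, v⟫ ^ 2
        = Hess φ p (e i₀) (e i₀) - ⟪gradient φ p, e i₀⟫ ^ 2 := by
    have he : ‖e i₀‖ = 1 := e.norm_eq_one i₀
    have := quartic_coefficient_eq e (X := fun v t ↦ γ p v t - p) (G := gradient φ p)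
      (b := geodesicJerk φ p) (C := fun t ↦ c t - p) (R := fun t ↦ r t ^ 2 - ‖c t - p‖ ^ 2)
      (fun v hv ↦ by
        obtain ⟨hε, hg, h0, h1⟩ := hgeo p hp v hv
        exact hg.hasExpansion hε h0 h1 hv hφp)
      geodesicJerk_neg
      (by
        filter_upwards [Ioo_mem_nhdsGT (hδ p hp)] with t ht v hv
        rw [← hcr t ht v hv, ← sub_sub_sub_cancel_right (γ p v t) (c t) p,
          norm_sub_sq_real (γ p v t - p) (c t - p)]
        ring)
      hv he
    rw [inner_geodesicJerk hv, inner_geodesicJerk he] at this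
    linarith
  have hsymm : IsSymmSndFDerivAt ℝ φ p := hφp.isSymmSndFDerivAt (by simp)
  have := bilin_eq_mul_inner
    (LinearMap.mk₂ ℝ (fun v w ↦ Hess φ p v w - ⟪gradient φ p, v⟫ * ⟪gradient φ p, w⟫)
      (by
        intros
        simp only [Hess, map_add, inner_add_right, add_apply]
        ring)
      (by
        intros
        simp only [Hess, map_smul, real_inner_smul_right,
          smul_apply, smul_eq_mul]
        ring)
      (by
        intros
        simp only [Hess, map_add, inner_add_right]
        ring)
      (by
        intros
        simp only [Hess, map_smul, real_inner_smul_right, smul_eq_mul]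
        ring))
    (fun v w ↦ by
      simp only [LinearMap.mk₂_apply, Hess, hsymm.eq v w]
      ring)
    (fun v hv ↦ by
      rw [LinearMap.mk₂_apply, ← sq]
      exact hunit hv) v w
  rw [LinearMap.mk₂_apply] at this
  linarith
end
end

section
/- Let n ≥ 2 and let U ⊆ ℝⁿ be an open set, and let φ : U → ℝ be smooth. Suppose that for every p ∈ U and every unit vector v ∈ ℝⁿ there are ε(p,v) > 0 and a curve γ_{p,v} : (−ε(p,v), ε(p,v)) → U solving the conformal geodesic equation for φ with γ_{p,v}(0) = p and γ_{p,v}′(0) = v. Assume moreover that for every p ∈ U there is δ(p) > 0 such that for each t ∈ (0, δ(p)) all the curves γ_{p,v} (‖v‖ = 1) are defined at t and the set { γ_{p,v}(t) : ‖v‖ = 1 } is a Euclidean sphere, i.e. equals { x ∈ ℝⁿ : ‖x − c‖ = r } for some c ∈ ℝⁿ and r > 0. Then the function h := e^{−φ} satisfies Hess h_p(v, w) = (Δh(p)/n)·⟨v, w⟩ for all p ∈ U and all v, w ∈ ℝⁿ, where Δ denotes the Euclidean Laplacian. -/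
open scoped RealInnerProductSpace

noncomputable section

/-- The Euclidean Laplacian of `φ` at `p`: the trace of the Hessian. -/
def lap {n : ℕ} (φ : EuclideanSpace ℝ (Fin n) → ℝ)
    (p : EuclideanSpace ℝ (Fin n)) : ℝ :=
  ∑ i : Fin n, Hess φ p (EuclideanSpace.single i 1) (EuclideanSpace.single i 1)

open Filter Topology Asymptotics

section Taylor

variable {F : Type*} [NormedAddCommGroup F] [NormedSpace ℝ F]

/-- If `f 0 = 0` and `f' = o(tⁿ)` at `0`, then `f = o(tⁿ⁺¹)`. -/
theorem isLittleO_pow_succ_of_hasDerivAt {f f' : ℝ → F} {n : ℕ}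
    (hf : ∀ᶠ t in 𝓝 0, HasDerivAt f (f' t) t) (h0 : f 0 = 0)
    (hf' : f' =o[𝓝 0] fun t : ℝ => t ^ n) :
    f =o[𝓝 0] fun t : ℝ => t ^ (n + 1) := by
  rw [isLittleO_iff]
  intro c hc
  obtain ⟨r, hr, hball⟩ := Metric.eventually_nhds_iff_ball.1 (hf.and (hf'.bound hc))
  filter_upwards [Metric.ball_mem_nhds (0 : ℝ) hr] with t ht
  have hsub : ∀ x ∈ Metric.closedBall (0 : ℝ) |t|, x ∈ Metric.ball (0 : ℝ) r := by
    intro x hx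
    simp only [Metric.mem_closedBall, Metric.mem_ball, dist_zero_right, Real.norm_eq_abs] at *
    exact hx.trans_lt ht
  have key := (convex_closedBall (0 : ℝ) |t|).norm_image_sub_le_of_norm_hasDerivWithin_le
    (f := f) (f' := f') (C := c * |t| ^ n) (x := 0) (y := t)
    (fun x hx => (hball x (hsub x hx)).1.hasDerivWithinAt)
    (fun x hx => by
      refine (hball x (hsub x hx)).2.trans ?_
      rw [norm_pow, Real.norm_eq_abs]
      have : |x| ≤ |t| := by simpa using hx
      gcongr)
    (by simp) (by simp)
  simpa [h0, pow_succ, mul_assoc] using key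

/-- Third order Taylor expansion with Peano remainder. -/
theorem tendsto_taylor_three {f f' f'' : ℝ → F} {k : F}
    (hf : ∀ᶠ t in 𝓝 0, HasDerivAt f (f' t) t)
    (hf' : ∀ᶠ t in 𝓝 0, HasDerivAt f' (f'' t) t)
    (hf'' : HasDerivAt f'' k 0) :
    Tendsto (fun t : ℝ => (t ^ 3)⁻¹ •
      (f t - f 0 - t • f' 0 - (t ^ 2 / 2) • f'' 0 - (t ^ 3 / 6) • k)) (𝓝 0) (𝓝 0) := by
  have h2 : (fun t : ℝ => f'' t - f'' 0 - t • k) =o[𝓝 0] fun t : ℝ => t ^ 1 := by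
    simpa using hasDerivAt_iff_isLittleO.1 hf''
  have h1 := isLittleO_pow_succ_of_hasDerivAt
    (f := fun t => f' t - f' 0 - t • f'' 0 - (t ^ 2 / 2) • k) (f' := _) ?_ (by simp) h2
  · have h0 := isLittleO_pow_succ_of_hasDerivAt
      (f := fun t => f t - f 0 - t • f' 0 - (t ^ 2 / 2) • f'' 0 - (t ^ 3 / 6) • k)
      (f' := _) ?_ (by simp) h1
    · exact h0.tendsto_inv_smul_nhds_zero
    · filter_upwards [hf] with t ht
      have e1 := (hasDerivAt_id t).smul_const (f' 0)
      have e2 := (((hasDerivAt_id t).pow 2).div_const 2).smul_const (f'' 0)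
      have e3 := (((hasDerivAt_id t).pow 3).div_const 6).smul_const k
      refine ((((ht.sub_const (f 0)).sub e1).sub e2).sub e3).congr_deriv ?_
      simp only [id]
      module
  · filter_upwards [hf'] with t ht
    have e1 := (hasDerivAt_id t).smul_const (f'' 0)
    have e2 := (((hasDerivAt_id t).pow 2).div_const 2).smul_const k
    refine (((ht.sub_const (f' 0)).sub e1).sub e2).congr_deriv ?_
    simp only [id]
    module

end Taylor

section InnerProduct

variable {E : Type*} [NormedAddCommGroup E] [InnerProductSpace ℝ E]

/-- A family whose inner products with vectors converging to an orthonormal basis tend to `0`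
tends to `0`. -/
theorem tendsto_zero_of_tendsto_inner {ι α : Type*} [Fintype ι] (e : OrthonormalBasis ι ℝ E)
    {l : Filter α} {u : ι → α → E} {Y : α → E} (hu : ∀ i, Tendsto (u i) l (𝓝 (e i)))
    (hY : ∀ i, Tendsto (fun t => ⟪u i t, Y t⟫) l (𝓝 0)) : Tendsto Y l (𝓝 0) := by
  have hlo : (fun t => ∑ i, ⟪u i t - e i, Y t⟫ • e i) =o[l] Y := by
    refine IsLittleO.fun_sum fun i _ => ?_
    have h1 : (fun t => u i t - e i) =o[l] fun _ => (1 : ℝ) := by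
      rw [isLittleO_one_iff]
      simpa using (hu i).sub_const (e i)
    have h2 : (fun t => ⟪u i t - e i, Y t⟫ • e i) =O[l]
        fun t => ‖u i t - e i‖ * ‖Y t‖ := by
      refine IsBigO.of_bound 1 (Eventually.of_forall fun t => ?_)
      rw [norm_smul, e.norm_eq_one, mul_one, one_mul, norm_mul, norm_norm, norm_norm]
      exact norm_inner_le_norm _ _
    have h3 : (fun t => ‖u i t - e i‖ * ‖Y t‖) =o[l] fun t => (1 : ℝ) * ‖Y t‖ :=
      h1.norm_left.mul_isBigO (isBigO_refl _ _)
    simpa using h2.trans_isLittleO h3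
  have hsum : Tendsto (fun t => ∑ i, ⟪u i t, Y t⟫ • e i) l (𝓝 0) := by
    simpa using tendsto_finsetSum Finset.univ fun i _ => (hY i).smul_const (e i)
  have hO := hlo.right_isBigO_add
  have heq : (fun t => (∑ i, ⟪u i t - e i, Y t⟫ • e i) + Y t) =
      fun t => ∑ i, ⟪u i t, Y t⟫ • e i := by
    funext t
    simp only [inner_sub_left, sub_smul, Finset.sum_sub_distrib, e.sum_repr', sub_add_cancel]
  rw [heq] at hO
  exact hO.trans_tendsto hsum

/-- Curves through `p` which at each small time `t` lie on a common sphere: comparing third order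
expansions, a certain combination of the Taylor coefficients is independent of the direction. -/
theorem taylor_coeff_eq_of_cospherical [FiniteDimensional ℝ E] {p g : E} {γ : E → ℝ → E}
    {b k : E → E}
    (hγ : ∀ v, ‖v‖ = 1 → Tendsto (fun t : ℝ => (t ^ 3)⁻¹ •
      (γ v t - p - t • v - (t ^ 2 / 2) • b v - (t ^ 3 / 6) • k v)) (𝓝[>] 0) (𝓝 0))
    (hb : ∀ v, ‖v‖ = 1 → ⟪v, b v⟫ = -⟪v, g⟫)
    (hb_neg : ∀ v, b (-v) = b v) (hk_neg : ∀ v, k (-v) = -k v)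
    (hs : ∀ᶠ t in 𝓝[>] (0 : ℝ), ∃ (c : E) (r : ℝ), ∀ v, ‖v‖ = 1 → ‖γ v t - c‖ = r)
    {u v : E} (hu : ‖u‖ = 1) (hv : ‖v‖ = 1) :
    ‖b u‖ ^ 2 / 4 + ⟪u, k u⟫ / 3 + ⟪b u, g⟫ / 2 =
      ‖b v‖ ^ 2 / 4 + ⟪v, k v⟫ / 3 + ⟪b v, g⟫ / 2 := by
  set η : E → ℝ → E := fun v t => (t ^ 3)⁻¹ •
    (γ v t - p - t • v - (t ^ 2 / 2) • b v - (t ^ 3 / 6) • k v) with hη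
  set m : E → ℝ → E := fun v t => v + (t / 2) • b v + (t ^ 2 / 6) • k v + t ^ 2 • η v t with hm
  have hγm : ∀ v, ∀ t : ℝ, 0 < t → γ v t = p + t • m v t := by
    intro v t ht
    have : t ^ 3 • η v t =
        γ v t - p - t • v - (t ^ 2 / 2) • b v - (t ^ 3 / 6) • k v := by
      simp only [hη]
      rw [smul_inv_smul₀ (by positivity)]
    have h2 : t • m v t = t • v + (t ^ 2 / 2) • b v + (t ^ 3 / 6) • k v + t ^ 3 • η v t := by
      simp only [hm]
      module
    rw [h2, this]
    abel
  have ht0 : Tendsto (fun t : ℝ => t) (𝓝[>] 0) (𝓝 0) :=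
    tendsto_nhdsWithin_of_tendsto_nhds tendsto_id
  have hmlim : ∀ v, ‖v‖ = 1 → Tendsto (m v) (𝓝[>] 0) (𝓝 v) := by
    intro v hv
    have := (((tendsto_const_nhds (x := v)).add ((ht0.div_const 2).smul_const (b v))).add
      (((ht0.pow 2).div_const 6).smul_const (k v))).add ((ht0.pow 2).smul (hγ v hv))
    simpa using this
  have hpos : ∀ᶠ t in 𝓝[>] (0 : ℝ), 0 < t := eventually_mem_nhdsWithin
  obtain ⟨c, hc⟩ : ∃ c : ℝ → E, ∀ᶠ t in 𝓝[>] (0 : ℝ), ∀ v w, ‖v‖ = 1 → ‖w‖ = 1 →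
      ‖γ v t - c t‖ = ‖γ w t - c t‖ := by
    have : ∀ t, ∃ c : E, (∃ (c : E) (r : ℝ), ∀ v, ‖v‖ = 1 → ‖γ v t - c‖ = r) →
        ∀ v w, ‖v‖ = 1 → ‖w‖ = 1 → ‖γ v t - c‖ = ‖γ w t - c‖ := by
      intro t
      by_cases h : ∃ (c : E) (r : ℝ), ∀ v, ‖v‖ = 1 → ‖γ v t - c‖ = r
      · obtain ⟨c, r, hcr⟩ := h
        exact ⟨c, fun _ v w hv hw => (hcr v hv).trans (hcr w hw).symm⟩
      · exact ⟨0, fun h' => absurd h' h⟩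
    choose c hc using this
    exact ⟨c, hs.mono fun t ht => hc t ht⟩
  -- `Y` is the rescaled deviation of the centre from `p - (t² / 2) g`
  set Y : ℝ → E := fun t => t⁻¹ • ((2 * (t ^ 2)⁻¹) • (c t - p) + g) with hYdef
  have hcY : ∀ t : ℝ, 0 < t → c t = p + (t ^ 2 / 2) • (t • Y t - g) := by
    intro t ht
    simp only [hYdef]
    rw [smul_inv_smul₀ ht.ne', add_sub_cancel_right, smul_smul]
    have : t ^ 2 / 2 * (2 * (t ^ 2)⁻¹) = 1 := by field_simp
    rw [this, one_smul]; abel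
  have hD : ∀ᶠ t in 𝓝[>] (0 : ℝ), ∀ v w, ‖v‖ = 1 → ‖w‖ = 1 →
      ⟪m v t, m v t⟫ + t * ⟪m v t, g⟫ - t ^ 2 * ⟪m v t, Y t⟫ =
      ⟪m w t, m w t⟫ + t * ⟪m w t, g⟫ - t ^ 2 * ⟪m w t, Y t⟫ := by
    filter_upwards [hc, hpos] with t ht htpos v w hv hw
    have h1 : ⟪γ v t - c t, γ v t - c t⟫ = ⟪γ w t - c t, γ w t - c t⟫ := by
      rw [real_inner_self_eq_norm_sq, real_inner_self_eq_norm_sq, ht v w hv hw]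
    have h2 : ∀ v, γ v t - c t = t • (m v t - (t / 2) • (t • Y t - g)) := by
      intro v
      rw [hγm v t htpos, hcY t htpos]
      module
    rw [h2, h2] at h1
    simp only [inner_sub_left, inner_sub_right, inner_smul_left, inner_smul_right,
      conj_trivial, real_inner_comm (m _ t) (Y t), real_inner_comm (m _ t) g] at h1
    have ht2 : t ^ 2 ≠ 0 := by positivity
    apply mul_left_cancel₀ ht2
    linear_combination h1
  have hYlim : Tendsto Y (𝓝[>] 0) (𝓝 0) := by
    refine tendsto_zero_of_tendsto_inner (stdOrthonormalBasis ℝ E)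
      (u := fun i t => (1 / 2 : ℝ) • (m (stdOrthonormalBasis ℝ E i) t
        - m (-stdOrthonormalBasis ℝ E i) t)) ?_ ?_
    · intro i
      have h1 : ‖stdOrthonormalBasis ℝ E i‖ = 1 := (stdOrthonormalBasis ℝ E).norm_eq_one i
      have := ((hmlim _ h1).sub (hmlim _ ((norm_neg _).trans h1))).const_smul (1 / 2 : ℝ)
      convert this using 2
      module
    · intro i
      have h1 : ‖stdOrthonormalBasis ℝ E i‖ = 1 := (stdOrthonormalBasis ℝ E).norm_eq_one i
      generalize stdOrthonormalBasis ℝ E i = v at *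
      have h1' : ‖-v‖ = 1 := (norm_neg _).trans h1
      -- the limit of the right-hand side of the explicit formula for `⟪u, Y⟫`
      have hw : Tendsto (fun t => (1 / 6 : ℝ) • k v + (1 / 2 : ℝ) • (η v t - η (-v) t))
          (𝓝[>] 0) (𝓝 ((1 / 6 : ℝ) • k v + (1 / 2 : ℝ) • (0 - 0))) :=
        tendsto_const_nhds.add (((hγ v h1).sub (hγ _ h1')).const_smul _)
      have hζ : Tendsto (fun t => η v t + η (-v) t) (𝓝[>] 0) (𝓝 (0 + 0)) :=
        (hγ v h1).add (hγ _ h1')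
      have hlim : Tendsto (fun t : ℝ => ⟪v, η v t + η (-v) t⟫ +
          t * ⟪(1 / 6 : ℝ) • k v + (1 / 2 : ℝ) • (η v t - η (-v) t),
            b v + g + t • (η v t + η (-v) t)⟫) (𝓝[>] 0) (𝓝 0) := by
        have := ((tendsto_const_nhds (x := v)).inner hζ).add
          (ht0.mul (hw.inner ((tendsto_const_nhds (x := b v + g)).add (ht0.smul hζ))))
        simpa using this
      refine hlim.congr' ?_
      filter_upwards [hD, hpos] with t ht htpos
      have h2 := ht v (-v) h1 h1'
      have ht2 : t ^ 2 ≠ 0 := by positivity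
      apply mul_left_cancel₀ ht2
      have hb' := hb v h1
      have e1 : m v t = (t / 2) • (b v + t • (η v t + η (-v) t)) +
          (v + t ^ 2 • ((1 / 6 : ℝ) • k v + (1 / 2 : ℝ) • (η v t - η (-v) t))) := by
        simp only [hm]
        module
      have e2 : m (-v) t = (t / 2) • (b v + t • (η v t + η (-v) t)) -
          (v + t ^ 2 • ((1 / 6 : ℝ) • k v + (1 / 2 : ℝ) • (η v t - η (-v) t))) := by
        simp only [hm, hb_neg, hk_neg]
        module
      rw [e1, e2] at h2 ⊢
      generalize η v t + η (-v) t = ζ at h2 ⊢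
      generalize (1 / 6 : ℝ) • k v + (1 / 2 : ℝ) • (η v t - η (-v) t) = w at h2 ⊢
      generalize Y t = y at h2 ⊢
      have e3 : (1 / 2 : ℝ) • ((t / 2) • (b v + t • ζ) + (v + t ^ 2 • w) -
          ((t / 2) • (b v + t • ζ) - (v + t ^ 2 • w))) = v + t ^ 2 • w := by module
      rw [e3]
      simp only [inner_add_left, inner_add_right, inner_sub_left, inner_sub_right,
        inner_smul_left, inner_smul_right, conj_trivial, real_inner_comm v (b v),
        real_inner_comm w (b v), real_inner_comm v ζ, real_inner_comm w ζ] at h2 ⊢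
      linear_combination (1 / 2) * h2 - t * hb'
  have hlim : ∀ v, ‖v‖ = 1 → Tendsto (fun t : ℝ => (t ^ 2)⁻¹ *
      (⟪m v t, m v t⟫ + t * ⟪m v t, g⟫ - t ^ 2 * ⟪m v t, Y t⟫ - 1)) (𝓝[>] 0)
      (𝓝 (‖b v‖ ^ 2 / 4 + ⟪v, k v⟫ / 3 + ⟪b v, g⟫ / 2)) := by
    intro v hv
    -- with `κ = k / 6 + η`, so that `m = v + (t / 2) b + t² κ`
    have hκ : Tendsto (fun t => (1 / 6 : ℝ) • k v + η v t) (𝓝[>] 0)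
        (𝓝 ((1 / 6 : ℝ) • k v + 0)) := tendsto_const_nhds.add (hγ v hv)
    have h1 : Tendsto (fun t : ℝ => ‖b v‖ ^ 2 / 4 +
        2 * ⟪v, (1 / 6 : ℝ) • k v + η v t⟫ + ⟪b v, g⟫ / 2
        + t * (⟪b v, (1 / 6 : ℝ) • k v + η v t⟫ + ⟪(1 / 6 : ℝ) • k v + η v t, g⟫)
        + t ^ 2 * ⟪(1 / 6 : ℝ) • k v + η v t, (1 / 6 : ℝ) • k v + η v t⟫
        - ⟪m v t, Y t⟫) (𝓝[>] 0)
        (𝓝 (‖b v‖ ^ 2 / 4 + 2 * ⟪v, (1 / 6 : ℝ) • k v + 0⟫ + ⟪b v, g⟫ / 2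
        + 0 * (⟪b v, (1 / 6 : ℝ) • k v + 0⟫ + ⟪(1 / 6 : ℝ) • k v + 0, g⟫)
        + 0 ^ 2 * ⟪(1 / 6 : ℝ) • k v + 0, (1 / 6 : ℝ) • k v + 0⟫
        - ⟪v, (0 : E)⟫)) := by
      refine ((((?_ : Tendsto _ _ _).add ?_).add ?_).sub ((hmlim v hv).inner hYlim))
      · exact (tendsto_const_nhds.add ((tendsto_const_nhds.inner hκ).const_mul 2)).add
          tendsto_const_nhds
      · exact ht0.mul ((tendsto_const_nhds.inner hκ).add (hκ.inner tendsto_const_nhds))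
      · exact (ht0.pow 2).mul (hκ.inner hκ)
    have h2 : (‖b v‖ ^ 2 / 4 + 2 * ⟪v, (1 / 6 : ℝ) • k v + 0⟫ + ⟪b v, g⟫ / 2
        + 0 * (⟪b v, (1 / 6 : ℝ) • k v + 0⟫ + ⟪(1 / 6 : ℝ) • k v + 0, g⟫)
        + 0 ^ 2 * ⟪(1 / 6 : ℝ) • k v + 0, (1 / 6 : ℝ) • k v + 0⟫
        - ⟪v, (0 : E)⟫) = ‖b v‖ ^ 2 / 4 + ⟪v, k v⟫ / 3 + ⟪b v, g⟫ / 2 := by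
      rw [add_zero, inner_smul_right, inner_zero_right]
      ring
    rw [h2] at h1
    refine h1.congr' ?_
    filter_upwards [hpos] with t htpos
    have ht2 : t ^ 2 ≠ 0 := by positivity
    have e1 : m v t = v + (t / 2) • b v + t ^ 2 • ((1 / 6 : ℝ) • k v + η v t) := by
      simp only [hm]
      module
    rw [eq_inv_mul_iff_mul_eq₀ ht2]
    generalize hYt : ⟪m v t, Y t⟫ = y
    rw [e1]
    generalize (1 / 6 : ℝ) • k v + η v t = κ
    have hb' := hb v hv
    have hv' : ⟪v, v⟫ = 1 := by rw [real_inner_self_eq_norm_sq, hv, one_pow]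
    simp only [inner_add_left, inner_add_right, inner_smul_left, inner_smul_right,
      conj_trivial, real_inner_comm v (b v), real_inner_comm v κ, real_inner_comm (b v) κ]
    rw [← real_inner_self_eq_norm_sq]
    linear_combination -hv' - t * hb'
  refine tendsto_nhds_unique_of_eventuallyEq (hlim u hu) (hlim v hv) ?_
  filter_upwards [hD] with t ht
  rw [ht u v hu hv]

end InnerProduct

section Calculus

variable {E : Type*} [NormedAddCommGroup E] [InnerProductSpace ℝ E]

theorem exists_hasFDerivAt_gradient [FiniteDimensional ℝ E] {φ : E → ℝ} {p : E}
    {D : E →L[ℝ] E →L[ℝ] ℝ} (hD : HasFDerivAt (fderiv ℝ φ) D p) :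
    ∃ G : E →L[ℝ] E, HasFDerivAt (gradient φ) G p ∧ ∀ v w, ⟪G v, w⟫ = D v w := by
  set e := stdOrthonormalBasis ℝ E
  refine ⟨∑ i, ((ContinuousLinearMap.apply ℝ ℝ (e i)).comp D).smulRight (e i), ?_, fun v w => ?_⟩
  · have hgrad : gradient φ = fun x => ∑ i, fderiv ℝ φ x (e i) • e i := by
      funext x
      simp only [← inner_gradient_left, real_inner_comm (e _) (gradient φ x)]
      exact (e.sum_repr' _).symm
    rw [hgrad]
    exact HasFDerivAt.fun_sum fun i _ =>
      (((ContinuousLinearMap.apply ℝ ℝ (e i)).hasFDerivAt.comp p hD).smul_const (e i))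
  · conv_rhs => rw [← e.sum_repr' w]
    simp [sum_inner, inner_smul_left, map_sum, mul_comm]

/-- Third order expansion at `0` of a solution of the conformal geodesic equation. -/
theorem tendsto_taylor_three_of_geodesic [CompleteSpace E] {φ : E → ℝ} {γ : ℝ → E} {ε : ℝ}
    (hε : 0 < ε) (hγ : ContDiffOn ℝ 2 γ (Set.Ioo (-ε) ε))
    (hode : ∀ t ∈ Set.Ioo (-ε) ε, deriv (deriv γ) t = (‖deriv γ t‖ ^ 2) • gradient φ (γ t)
        - (2 * ⟪gradient φ (γ t), deriv γ t⟫) • deriv γ t)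
    {p v g : E} {G : E →L[ℝ] E} (hG : HasFDerivAt (gradient φ) G p) (hg : gradient φ p = g)
    (h0 : γ 0 = p) (h1 : deriv γ 0 = v) (hv : ‖v‖ = 1) :
    Tendsto (fun t : ℝ => (t ^ 3)⁻¹ • (γ t - p - t • v - (t ^ 2 / 2) • (g - (2 * ⟪g, v⟫) • v)
      - (t ^ 3 / 6) • (G v - (2 * ⟪G v, v⟫) • v - (4 * ⟪g, v⟫) • g
        + (8 * ⟪g, v⟫ ^ 2 - 2 * ‖g‖ ^ 2) • v))) (𝓝 0) (𝓝 0) := by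
  have hmem : Set.Ioo (-ε) ε ∈ 𝓝 (0 : ℝ) := Ioo_mem_nhds (by linarith) hε
  have hγ' : ContDiffOn ℝ 1 (deriv γ) (Set.Ioo (-ε) ε) :=
    hγ.deriv_of_isOpen isOpen_Ioo (by norm_num)
  have hd1 : ∀ᶠ t in 𝓝 0, HasDerivAt γ (deriv γ t) t := by
    filter_upwards [eventually_mem_nhds_iff.2 hmem] with t ht
    exact ((hγ.contDiffAt ht).differentiableAt (by norm_num)).hasDerivAt
  have hd2 : ∀ᶠ t in 𝓝 0, HasDerivAt (deriv γ) (deriv (deriv γ) t) t := by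
    filter_upwards [eventually_mem_nhds_iff.2 hmem] with t ht
    exact ((hγ'.contDiffAt ht).differentiableAt (by norm_num)).hasDerivAt
  have hb : deriv (deriv γ) 0 = g - (2 * ⟪g, v⟫) • v := by
    rw [hode 0 (mem_of_mem_nhds hmem), h0, h1, hv, hg, one_pow, one_smul]
  have hvv : ⟪v, v⟫ = 1 := by rw [real_inner_self_eq_norm_sq, hv, one_pow]
  have e1 : HasDerivAt (deriv γ) (g - (2 * ⟪g, v⟫) • v) 0 := hb ▸ hd2.self_of_nhds
  have e2 : HasDerivAt (fun t => gradient φ (γ t)) (G v) 0 := by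
    have := hd1.self_of_nhds
    rw [h1] at this
    exact (h0.symm ▸ hG).comp_hasDerivAt (0 : ℝ) this
  have hd3 : HasDerivAt (deriv (deriv γ)) (G v - (2 * ⟪G v, v⟫) • v - (4 * ⟪g, v⟫) • g
        + (8 * ⟪g, v⟫ ^ 2 - 2 * ‖g‖ ^ 2) • v) 0 := by
    have e3 := (e1.norm_sq.smul e2).sub (((e2.inner ℝ e1).const_mul 2).smul e1)
    refine (e3.congr_of_eventuallyEq ?_).congr_deriv ?_
    · filter_upwards [hmem] with t ht
      exact hode t ht
    · simp only [h0, h1, hg, hv, inner_sub_right, inner_smul_right, hvv,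
        real_inner_comm g v, ← real_inner_self_eq_norm_sq]
      module
  have := tendsto_taylor_three hd1 hd2 hd3
  rwa [h0, h1, hb] at this

/-- A symmetric bilinear form that is constant on the unit sphere is a multiple of the inner
product. -/
theorem bilin_eq_of_const_on_sphere {B : E →L[ℝ] E →L[ℝ] ℝ} (hB : ∀ v w, B v w = B w v) {c : ℝ}
    (hc : ∀ v, ‖v‖ = 1 → B v v = c) (v w : E) : B v w = c * ⟪v, w⟫ := by
  have hq : ∀ x, B x x = c * ⟪x, x⟫ := by
    intro x
    rcases eq_or_ne x 0 with rfl | hx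
    · simp
    · have hx' : ‖x‖ ≠ 0 := norm_ne_zero_iff.2 hx
      have := hc (‖x‖⁻¹ • x) (norm_smul_inv_norm hx)
      simp only [map_smul, smul_apply, smul_eq_mul] at this
      rw [real_inner_self_eq_norm_sq, ← this]
      field_simp
  have h1 := hq (v + w)
  simp only [map_add, add_apply, inner_add_left, inner_add_right, hq,
    hB w v, real_inner_comm v w] at h1
  linarith

theorem fderiv_fderiv_exp_neg {φ : E → ℝ} {p : E} (hφ : ContDiffAt ℝ 2 φ p) (v w : E) :
    fderiv ℝ (fderiv ℝ fun x => Real.exp (-φ x)) p v w =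
      Real.exp (-φ p) * (fderiv ℝ φ p v * fderiv ℝ φ p w - fderiv ℝ (fderiv ℝ φ) p v w) := by
  have h1 : fderiv ℝ (fun x => Real.exp (-φ x)) =ᶠ[𝓝 p]
      fun x => Real.exp (-φ x) • -fderiv ℝ φ x := by
    filter_upwards [hφ.eventually (by simp)] with x hx
    exact (hx.differentiableAt (by norm_num)).hasFDerivAt.neg.exp.fderiv
  have h2 : HasFDerivAt (fderiv ℝ φ) (fderiv ℝ (fderiv ℝ φ) p) p :=
    ((hφ.fderiv_right (m := 1) (by norm_num)).differentiableAt (by norm_num)).hasFDerivAt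
  have h3 := (hφ.differentiableAt (by norm_num)).hasFDerivAt.neg.exp.smul h2.neg
  rw [(h3.congr_of_eventuallyEq h1).fderiv]
  simp
  ring

end Calculus

/-- If all sufficiently small geodesic hyperspheres of the conformally flat metric
`e^{2φ}·g_euc` are Euclidean spheres, then `h = e^{−φ}` satisfies
`Hess h = (Δh/n)·g`. -/
theorem cospherical_concircular {n : ℕ} (hn : 2 ≤ n)
    (U : Set (EuclideanSpace ℝ (Fin n))) (hU : IsOpen U)
    (φ : EuclideanSpace ℝ (Fin n) → ℝ) (hφ : ContDiffOn ℝ (⊤ : ℕ∞) φ U)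
    (ε : EuclideanSpace ℝ (Fin n) → EuclideanSpace ℝ (Fin n) → ℝ)
    (γ : EuclideanSpace ℝ (Fin n) → EuclideanSpace ℝ (Fin n) → ℝ →
      EuclideanSpace ℝ (Fin n))
    (hgeo : ∀ p ∈ U, ∀ v : EuclideanSpace ℝ (Fin n), ‖v‖ = 1 →
      0 < ε p v ∧ IsConformalGeodesic U φ (ε p v) (γ p v) ∧
      γ p v 0 = p ∧ deriv (γ p v) 0 = v)
    (δ : EuclideanSpace ℝ (Fin n) → ℝ)
    (hδ : ∀ p ∈ U, 0 < δ p)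
    (hsph : ∀ p ∈ U, ∀ t ∈ Set.Ioo (0 : ℝ) (δ p),
      (∀ v : EuclideanSpace ℝ (Fin n), ‖v‖ = 1 → t < ε p v) ∧
      ∃ (c : EuclideanSpace ℝ (Fin n)) (r : ℝ), 0 < r ∧
        {x | ∃ v : EuclideanSpace ℝ (Fin n), ‖v‖ = 1 ∧ γ p v t = x} =
          {x | ‖x - c‖ = r})
    (h : EuclideanSpace ℝ (Fin n) → ℝ)
    (hh : ∀ x, h x = Real.exp (-φ x)) :
    ∀ p ∈ U, ∀ v w : EuclideanSpace ℝ (Fin n),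
      Hess h p v w = (lap h p / n) * ⟪v, w⟫ := by
  intro p hp
  have hφp : ContDiffAt ℝ 2 φ p :=
    (hφ.contDiffAt (hU.mem_nhds hp)).of_le (WithTop.coe_le_coe.2 (le_top : (2 : ℕ∞) ≤ ⊤))
  obtain ⟨G, hG, hGD⟩ := exists_hasFDerivAt_gradient
    ((hφp.fderiv_right (m := 1) (by norm_num)).differentiableAt (by norm_num)).hasFDerivAt
  obtain ⟨g, hg⟩ : ∃ g, gradient φ p = g := ⟨_, rfl⟩
  have hgφ : ∀ v, fderiv ℝ φ p v = ⟪g, v⟫ := fun v => by rw [← hg, inner_gradient_left]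
  have hHess : ∀ v w, fderiv ℝ (fderiv ℝ h) p v w =
      Real.exp (-φ p) * (⟪g, v⟫ * ⟪g, w⟫ - ⟪G v, w⟫) := fun v w => by
    rw [funext hh, fderiv_fderiv_exp_neg hφp, hgφ, hgφ, hGD]
  have hsymm : ∀ v w, fderiv ℝ (fderiv ℝ h) p v w = fderiv ℝ (fderiv ℝ h) p w v := by
    have hhp : ContDiffAt ℝ 2 h p := by
      rw [funext hh]
      exact hφp.neg.exp
    exact fun v w => hhp.isSymmSndFDerivAt (by simp) v w
  have hconst : ∀ u v : EuclideanSpace ℝ (Fin n), ‖u‖ = 1 → ‖v‖ = 1 →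
      fderiv ℝ (fderiv ℝ h) p u u = fderiv ℝ (fderiv ℝ h) p v v := by
    intro u v hu hv
    have key := taylor_coeff_eq_of_cospherical (p := p) (g := g) (γ := γ p)
      (b := fun v => g - (2 * ⟪g, v⟫) • v)
      (k := fun v => G v - (2 * ⟪G v, v⟫) • v - (4 * ⟪g, v⟫) • g
        + (8 * ⟪g, v⟫ ^ 2 - 2 * ‖g‖ ^ 2) • v) ?_ ?_ ?_ ?_ ?_ hu hv
    · have hF : ∀ v : EuclideanSpace ℝ (Fin n), ‖v‖ = 1 →
          ‖g - (2 * ⟪g, v⟫) • v‖ ^ 2 / 4 + ⟪v, G v - (2 * ⟪G v, v⟫) • v - (4 * ⟪g, v⟫) • g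
            + (8 * ⟪g, v⟫ ^ 2 - 2 * ‖g‖ ^ 2) • v⟫ / 3 + ⟪g - (2 * ⟪g, v⟫) • v, g⟫ / 2 =
          ⟪g, g⟫ / 12 + (⟪g, v⟫ * ⟪g, v⟫ - ⟪G v, v⟫) / 3 := by
        intro v hv
        have hvv : ⟪v, v⟫ = 1 := by rw [real_inner_self_eq_norm_sq, hv, one_pow]
        simp only [← real_inner_self_eq_norm_sq, inner_sub_left, inner_sub_right, inner_add_right,
          inner_smul_left, inner_smul_right, conj_trivial, hvv, real_inner_comm g v,
          real_inner_comm (G v) v]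
        ring
      rw [hF u hu, hF v hv] at key
      rw [hHess, hHess]
      linear_combination (3 * Real.exp (-φ p)) * key
    · intro v hv
      obtain ⟨hε, ⟨-, hC2, hode⟩, h0, h1⟩ := hgeo p hp v hv
      exact (tendsto_taylor_three_of_geodesic hε hC2 hode hG hg h0 h1 hv).mono_left
        nhdsWithin_le_nhds
    · intro v hv
      simp only [inner_sub_right, inner_smul_right, real_inner_self_eq_norm_sq, hv,
        real_inner_comm g v]
      ring
    · intro v
      simp
    · intro v
      simp only [map_neg, inner_neg_left, inner_neg_right]
      module
    · filter_upwards [Ioo_mem_nhdsGT (hδ p hp)] with t ht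
      obtain ⟨-, c, r, -, hcr⟩ := hsph p hp t ht
      exact ⟨c, r, fun v hv => hcr.subset ⟨v, hv, rfl⟩⟩
  have hn0 : 0 < n := by omega
  have hlap : ∀ v, ‖v‖ = 1 → fderiv ℝ (fderiv ℝ h) p v v = lap h p / n := by
    intro v hv
    have : lap h p = ∑ _i : Fin n, fderiv ℝ (fderiv ℝ h) p v v :=
      Finset.sum_congr rfl fun i _ => hconst _ _ (by simp) hv
    rw [this, Finset.sum_const, Finset.card_univ, Fintype.card_fin, nsmul_eq_mul]
    field_simp
  exact bilin_eq_of_const_on_sphere hsymm hlap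
end
end
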